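/- Let I be a C*-algebra whose multiplier algebra M(I) is extremally rich, and suppose a unital C*-algebra A contains I as a closed two-sided ideal. If the Busby invariant τ : A/I → C(I) maps extreme points of the closed unit ball of A/I to extreme points of the closed unit ball of C(I), then every extremal partial isometry in A/I lifts to an extremal partial isometry in A. -/

import Mathlib

open scoped MultiplierAlgebra

/-- A unital C*-algebra `A` is *extremally rich* if the set
`A⁻¹ 𝓔(A) A⁻¹ = {x * u * y : x, y invertible, u an extreme point of the closed unit ball}`
is dense in `A`. -/
def ExtremallyRich (A : Type*) [CStarAlgebra A] : Prop :=
  Dense {a : A | ∃ x u y : A, IsUnit x ∧ IsUnit y ∧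
    u ∈ Set.extremePoints ℝ (Metric.closedBall (0 : A) 1) ∧ a = x * u * y}

/-- A partial isometry `u` whose defect projections `1 - u u*` and `1 - u* u` are centrally
orthogonal. By `mem_extremePoints_closedBall_iff` these are exactly the extreme points of the
closed unit ball of a unital C*-algebra. -/
structure IsExtremalPartialIsometry {A : Type*} [CStarAlgebra A] (u : A) : Prop where
  mul_star_mul_self : u * star u * u = u
  defect_mul_mul_defect : ∀ a : A, (1 - u * star u) * a * (1 - star u * u) = 0

section Order

variable {A : Type*} [CStarAlgebra A] [PartialOrder A] [StarOrderedRing A]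

theorem norm_le_one_iff_star_mul_self_le_one (a : A) : ‖a‖ ≤ 1 ↔ star a * a ≤ 1 := by
  rw [← CStarAlgebra.norm_le_one_iff_of_nonneg _ (star_mul_self_nonneg a),
    CStarRing.norm_star_mul_self]
  constructor <;> intro h <;> nlinarith [norm_nonneg a]

theorem mul_star_mul_self_of_mem_extremePoints {u : A}
    (hu : u ∈ Set.extremePoints ℝ (Metric.closedBall (0 : A) 1)) : u * star u * u = u := by
  obtain ⟨hu1, hu⟩ := hu
  rw [mem_closedBall_zero_iff] at hu1
  have hle := (norm_le_one_iff_star_mul_self_le_one u).1 hu1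
  set h := star u * u with hh
  have hsa : star h = h := by simp [hh]
  have e4 : (4 : A) = (4 : ℝ) • (1 : A) := by
    rw [← Algebra.algebraMap_eq_smul_one, map_ofNat]
  have h4 : h ≤ 4 := by
    rw [e4]
    exact hle.trans (le_smul_of_one_le_left zero_le_one (by norm_num))
  have h1 : ‖(1 / 2 : ℝ) • (3 * u - u * h)‖ ≤ 1 := by
    rw [norm_le_one_iff_star_mul_self_le_one]
    have hnn : 0 ≤ star (1 - h) * (4 - h) * (1 - h) :=
      star_left_conjugate_nonneg (sub_nonneg.2 h4) _
    have hnn' : 0 ≤ (1 / 4 : ℝ) • (star (1 - h) * (4 - h) * (1 - h)) :=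
      smul_nonneg (by norm_num) hnn
    rw [← sub_nonneg]
    convert hnn' using 1
    have key : star (3 * u - u * h) * (3 * u - u * h) =
        4 - star (1 - h) * (4 - h) * (1 - h) := by
      simp only [star_sub, star_mul, hsa, star_one, star_ofNat]
      have e : (star u * 3 - h * star u) * (3 * u - u * h) = 9 * h - 6 * h * h + h * h * h := by
        rw [hh]; noncomm_ring
      have e' : (1 - h) * (4 - h) * (1 - h) = 4 - (9 * h - 6 * h * h + h * h * h) := by
        have : (4 : A) = (4 : ℤ) • 1 := by simp
        rw [this]; noncomm_ring
      rw [e, e', sub_sub_cancel]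
    have e1 : star (1 / 2 : ℝ) * (1 / 2 : ℝ) = 1 / 4 := by norm_num
    have e2 : (1 / 4 : ℝ) • (4 : A) = 1 := by rw [e4, smul_smul]; norm_num
    rw [star_smul, smul_mul_smul_comm, key, smul_sub, e1, e2, sub_sub_cancel]
  have h2 : ‖(1 / 2 : ℝ) • (u + u * h)‖ ≤ 1 := by
    rw [norm_smul]
    have hh1 : ‖h‖ ≤ 1 := by rw [hh, CStarRing.norm_star_mul_self]; nlinarith [norm_nonneg u]
    have := norm_add_le u (u * h)
    have := norm_mul_le u h
    norm_num
    nlinarith [norm_nonneg u, norm_nonneg h]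
  have := hu (mem_closedBall_zero_iff.2 h1) (mem_closedBall_zero_iff.2 h2)
    ⟨1 / 2, 1 / 2, by norm_num, by norm_num, by norm_num, by
      rw [← smul_add, ← smul_add, smul_smul,
        show 3 * u - u * h + (u + u * h) = (4 : ℝ) • u by
          rw [ofNat_smul_eq_nsmul]; noncomm_ring, smul_smul]
      norm_num⟩
  have h3 : 3 * u - u * h = (2 : ℝ) • u := by
    rw [← this, smul_smul]; norm_num [this]
  rw [ofNat_smul_eq_nsmul] at h3
  have : u = u * h := by
    rw [← sub_eq_zero, ← sub_eq_zero.2 h3]; noncomm_ring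
  rw [mul_assoc, ← hh, ← this]

theorem isExtremalPartialIsometry_of_mem_extremePoints {u : A}
    (hu : u ∈ Set.extremePoints ℝ (Metric.closedBall (0 : A) 1)) :
    IsExtremalPartialIsometry u := by
  have hpi := mul_star_mul_self_of_mem_extremePoints hu
  refine ⟨hpi, ?_⟩
  have hpi' : star u * u * star u = star u := by
    simpa [mul_assoc] using congrArg star hpi
  have hproj : IsStarProjection (1 - star u * u) := by
    refine IsStarProjection.one_sub ⟨?_, by simp [IsSelfAdjoint]⟩
    rw [IsIdempotentElem, ← mul_assoc, hpi']
  have key : ∀ b : A, star u * b = 0 → b * (1 - star u * u) = b → ‖b‖ ≤ 1 → ‖u + b‖ ≤ 1 := by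
    intro b h1 h2 h3
    rw [norm_le_one_iff_star_mul_self_le_one] at h3 ⊢
    have h4 : star b * u = 0 := by simpa using congrArg star h1
    have h5 : star b * b ≤ 1 - star u * u := by
      have := star_left_conjugate_le_conjugate h3 (1 - star u * u)
      rw [mul_one, hproj.isSelfAdjoint.star_eq, hproj.isIdempotentElem.eq] at this
      convert this using 1
      conv_lhs => rw [← h2]
      rw [star_mul, hproj.isSelfAdjoint.star_eq]
      simp only [mul_assoc]
    have h6 : star (u + b) * (u + b) = star u * u + star b * b := by
      rw [star_add, add_mul, mul_add, mul_add, h1, h4]; abel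
    rw [h6]
    exact (add_le_add_right h5 _).trans_eq (by abel)
  have key2 : ∀ b : A, star u * b = 0 → b * (1 - star u * u) = b → ‖b‖ ≤ 1 → b = 0 := by
    intro b h1 h2 h3
    have := hu.2 (mem_closedBall_zero_iff.2 (key b h1 h2 h3))
      (mem_closedBall_zero_iff.2 (key (-b) (by simp [h1]) (by rw [neg_mul, h2]) (by simpa)))
      ⟨1 / 2, 1 / 2, by norm_num, by norm_num, by norm_num, by
        rw [← smul_add, show u + b + (u + -b) = (2 : ℝ) • u by
          rw [two_smul]; abel, smul_smul]
        norm_num⟩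
    simpa using this
  intro a
  set b := (1 - u * star u) * a * (1 - star u * u) with hb
  have hb1 : star u * b = 0 := by
    rw [hb, ← mul_assoc, ← mul_assoc, mul_sub (star u), mul_one, ← mul_assoc, hpi', sub_self,
      zero_mul, zero_mul]
  have hb2 : b * (1 - star u * u) = b := by
    rw [hb, mul_assoc, hproj.isIdempotentElem.eq]
  by_contra hne
  have hn : 0 < ‖b‖ := norm_pos_iff.2 hne
  have := key2 (‖b‖⁻¹ • b) (by rw [mul_smul_comm, hb1, smul_zero])
    (by rw [smul_mul_assoc, hb2]) (by rw [norm_smul, norm_inv, norm_norm]; field_simp; rfl)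
  rw [smul_eq_zero] at this
  rcases this with h | h
  · exact (inv_pos.2 hn).ne' h
  · exact hne h

theorem mul_eq_zero_of_star_mul_self_le_one_sub {x p : A} (hp : IsStarProjection p)
    (h : star x * x ≤ 1 - p) : x * p = 0 := by
  have := star_left_conjugate_le_conjugate h p
  rw [mul_sub, mul_one, hp.isSelfAdjoint.star_eq, hp.isIdempotentElem.eq, sub_self] at this
  rw [← CStarRing.star_mul_self_eq_zero_iff]
  refine le_antisymm ?_ (star_mul_self_nonneg _)
  rw [star_mul, hp.isSelfAdjoint.star_eq]
  rw [zero_mul] at this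
  simpa only [mul_assoc] using this

/-- If a partial isometry is a proper convex combination of two contractions, these agree on its
initial space. -/
theorem sub_mul_star_mul_self_eq_zero {u a b : A} {s t : ℝ} (hu : u * star u * u = u)
    (ha : ‖a‖ ≤ 1) (hb : ‖b‖ ≤ 1) (hs : 0 < s) (ht : 0 < t) (hst : s + t = 1)
    (h : s • a + t • b = u) : (a - b) * (star u * u) = 0 := by
  have hproj : IsStarProjection (star u * u) := by
    refine ⟨?_, by simp [IsSelfAdjoint]⟩
    rw [IsIdempotentElem, mul_assoc, ← mul_assoc u, hu]
  rw [norm_le_one_iff_star_mul_self_le_one] at ha hb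
  have h1 : s • (star a * a) + t • (star b * b) ≤ 1 := by
    have := add_le_add (smul_le_smul_of_nonneg_left ha hs.le)
      (smul_le_smul_of_nonneg_left hb ht.le)
    rwa [← add_smul, hst, one_smul] at this
  have h2 : star (√(s * t) • (a - b)) * (√(s * t) • (a - b)) =
      s • (star a * a) + t • (star b * b) - star u * u := by
    rw [star_smul, smul_mul_smul_comm, star_trivial, Real.mul_self_sqrt (by positivity), ← h]
    obtain rfl : t = 1 - s := by linarith
    simp only [star_add, star_smul, star_trivial, star_sub, mul_add, add_mul, mul_sub, sub_mul,
      smul_mul_assoc, mul_smul_comm]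
    module
  have h3 := mul_eq_zero_of_star_mul_self_le_one_sub hproj (x := √(s * t) • (a - b))
    (by rw [h2]; exact sub_le_sub_right h1 _)
  rw [smul_mul_assoc, smul_eq_zero] at h3
  exact h3.resolve_left (Real.sqrt_ne_zero'.2 (by positivity))

end Order

namespace IsExtremalPartialIsometry

variable {A : Type*} [CStarAlgebra A] {u : A}

protected theorem star (hu : IsExtremalPartialIsometry u) :
    IsExtremalPartialIsometry (star u) := by
  refine ⟨by simpa [mul_assoc] using congrArg star hu.mul_star_mul_self, fun a => ?_⟩
  simpa [mul_assoc] using congrArg star (hu.defect_mul_mul_defect (star a))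

theorem isStarProjection_star_mul_self (hu : IsExtremalPartialIsometry u) :
    IsStarProjection (star u * u) := by
  refine ⟨?_, by simp [IsSelfAdjoint]⟩
  rw [IsIdempotentElem, mul_assoc, ← mul_assoc u, hu.mul_star_mul_self]

theorem mem_extremePoints_closedBall (hu : IsExtremalPartialIsometry u) :
    u ∈ Set.extremePoints ℝ (Metric.closedBall (0 : A) 1) := by
  let _ := CStarAlgebra.spectralOrder A
  have _ := CStarAlgebra.spectralOrderedRing A
  refine ⟨?_, ?_⟩
  · rw [mem_closedBall_zero_iff, norm_le_one_iff_star_mul_self_le_one]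
    exact hu.isStarProjection_star_mul_self.le_one
  · rintro a ha b hb ⟨s, t, hs, ht, hst, h⟩
    rw [mem_closedBall_zero_iff] at ha hb
    have h1 := sub_mul_star_mul_self_eq_zero hu.mul_star_mul_self ha hb hs ht hst h
    have h2 := sub_mul_star_mul_self_eq_zero (a := star a) (b := star b)
      hu.star.mul_star_mul_self (by simpa) (by simpa) hs ht hst
      (by simpa using congrArg star h)
    have h3 : u * star u * (a - b) = 0 := by simpa [mul_assoc] using congrArg star h2
    have h4 : a - b = 0 := by
      rw [← hu.defect_mul_mul_defect (a - b), sub_mul, h3, mul_sub, sub_zero, one_mul, h1]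
      simp
    obtain rfl := sub_eq_zero.1 h4
    rw [← h, ← add_smul, hst, one_smul]

end IsExtremalPartialIsometry

theorem mem_extremePoints_closedBall_iff {A : Type*} [CStarAlgebra A] (u : A) :
    u ∈ Set.extremePoints ℝ (Metric.closedBall (0 : A) 1) ↔ IsExtremalPartialIsometry u := by
  let _ := CStarAlgebra.spectralOrder A
  have _ := CStarAlgebra.spectralOrderedRing A
  exact ⟨isExtremalPartialIsometry_of_mem_extremePoints, (·.mem_extremePoints_closedBall)⟩

theorem Units.exists_one_le_smul_star_mul_self {A : Type*} [CStarAlgebra A] [PartialOrder A]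
    [StarOrderedRing A] (x : Aˣ) : ∃ r : ℝ, 1 ≤ r ∧ 1 ≤ r • (star (x : A) * x) := by
  have h := star_left_conjugate_le_conjugate
    (CStarAlgebra.star_mul_le_algebraMap_norm_sq (a := ((x⁻¹ : Aˣ) : A))) (x : A)
  have hl : star (x : A) * (star ((x⁻¹ : Aˣ) : A) * (x⁻¹ : Aˣ)) * x = 1 := by
    rw [← mul_assoc, ← star_mul]; simp
  rw [hl, Algebra.algebraMap_eq_smul_one, mul_smul_comm, mul_one, smul_mul_assoc] at h
  exact ⟨‖((x⁻¹ : Aˣ) : A)‖ ^ 2 + 1, by nlinarith [sq_nonneg ‖((x⁻¹ : Aˣ) : A)‖],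
    h.trans (smul_le_smul_of_nonneg_right (by linarith) (star_mul_self_nonneg _))⟩

namespace IsExtremalPartialIsometry

section Polar

variable {A : Type*} [CStarAlgebra A] [PartialOrder A] [StarOrderedRing A]

/-- Polar decomposition of the product of an invertible and an extremal partial isometry. -/
theorem exists_polar_of_isUnit_mul {x v : A}
    (hv : IsExtremalPartialIsometry v) (hx : IsUnit x) :
    ∃ w k : A, IsExtremalPartialIsometry w ∧ IsUnit k ∧ 0 ≤ k ∧
      Commute k (star w * w) ∧ x * v = w * k := by
  obtain ⟨x, rfl⟩ := hx
  have hp := hv.isStarProjection_star_mul_self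
  set p := star v * v with hpdef
  have hvp : v * p = v := by rw [hpdef, ← mul_assoc, hv.mul_star_mul_self]
  have hpv : p * star v = star v := by
    simpa [hp.isSelfAdjoint.star_eq] using congrArg star hvp
  have hpp : p * p = p := hp.isIdempotentElem
  set m := star v * (star (x : A) * x) * v with hm
  have hm0 : 0 ≤ m := star_left_conjugate_nonneg (star_mul_self_nonneg _) _
  have hmp : m * p = m := by rw [hm, mul_assoc, hvp]
  have hpm : p * m = m := by rw [hm, ← mul_assoc, ← mul_assoc, hpv]
  set h := m + (1 - p) with hh
  have hq0 : 0 ≤ 1 - p := hp.one_sub.nonneg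
  have hh0 : 0 ≤ h := add_nonneg hm0 hq0
  have hunit : IsUnit h := by
    obtain ⟨r, hr, hrx⟩ := x.exists_one_le_smul_star_mul_self
    have hrp : p ≤ r • m := by
      have := star_left_conjugate_le_conjugate hrx v
      rwa [mul_one, mul_smul_comm, smul_mul_assoc] at this
    have hrq : 1 - p ≤ r • (1 - p) := le_smul_of_one_le_left hq0 hr
    have h1 : 1 ≤ r • h := by
      rw [hh, smul_add]
      simpa using add_le_add hrp hrq
    exact (isUnit_smul_iff (Units.mk0 r (by positivity)) h).1 (CStarAlgebra.isUnit_of_le 1 h1)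
  have hhp : h * p = m := by rw [hh, add_mul, sub_mul, one_mul, hmp, hpp, sub_self, add_zero]
  have hph : p * h = m := by rw [hh, mul_add, mul_sub, mul_one, hpm, hpp, sub_self, add_zero]
  have hkk : CFC.sqrt h * CFC.sqrt h = h := CFC.sqrt_mul_sqrt_self h hh0
  have hkstar : star (CFC.sqrt h) = CFC.sqrt h := (CFC.sqrt_nonneg h).isSelfAdjoint.star_eq
  have hkp : Commute (CFC.sqrt h) p := by
    rw [CFC.sqrt_eq_cfc]
    exact Commute.cfc_nnreal (hhp.trans hph.symm) _
  obtain ⟨k, hk⟩ : IsUnit (CFC.sqrt h) := (CFC.isUnit_sqrt_iff h hh0).2 hunit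
  rw [← hk] at hkk hkstar hkp
  have hkinv : star ((k⁻¹ : Aˣ) : A) = (k⁻¹ : Aˣ) := by
    rw [← Units.coe_star_inv]
    congr 2
    exact Units.ext hkstar
  have hkip : Commute ((k⁻¹ : Aˣ) : A) p := hkp.units_inv_left
  have hww : star (x * v * (k⁻¹ : Aˣ)) * (x * v * (k⁻¹ : Aˣ)) = p := by
    have : star (x * v * (k⁻¹ : Aˣ)) * (x * v * (k⁻¹ : Aˣ)) =
        (k⁻¹ : Aˣ) * (k * k) * p * (k⁻¹ : Aˣ) := by
      rw [hkk, mul_assoc (_ * h), mul_assoc _ h, ← mul_assoc h, hhp, hm, star_mul, hkinv, star_mul]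
      simp only [mul_assoc]
    rw [this, Units.inv_mul_cancel_left, hkp.eq, Units.mul_inv_cancel_right]
  have hwp : x * v * (k⁻¹ : Aˣ) * p = x * v * (k⁻¹ : Aˣ) := by
    rw [mul_assoc, hkip.eq, ← mul_assoc, mul_assoc _ v, hvp]
  have hwk : x * v * (k⁻¹ : Aˣ) * k = x * v := Units.inv_mul_cancel_right _ _
  set w := x * v * (k⁻¹ : Aˣ)
  refine ⟨w, k, ⟨by rw [mul_assoc, hww, hwp], fun a => ?_⟩, k.isUnit,
    hk ▸ CFC.sqrt_nonneg h, by rwa [hww],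
    hwk.symm⟩
  rw [hww]
  have h1 : (1 - w * star w) * x * v = 0 := by
    rw [mul_assoc, ← hwk, ← mul_assoc, sub_mul, one_mul, mul_assoc w, hww, hwp, sub_self, zero_mul]
  have h2 := hv.defect_mul_mul_defect ((x⁻¹ : Aˣ) * a)
  calc (1 - w * star w) * a * (1 - p)
      = (1 - w * star w) * (x * ((x⁻¹ : Aˣ) * a)) * (1 - p) := by
        rw [Units.mul_inv_cancel_left]
    _ = (1 - w * star w) * x * v * star v * ((x⁻¹ : Aˣ) * a) * (1 - p) +
        (1 - w * star w) * x * ((1 - v * star v) * ((x⁻¹ : Aˣ) * a) * (1 - p)) := by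
        noncomm_ring
    _ = 0 := by rw [h1, h2]; simp

/-- Polar decomposition of quasi-invertible elements. -/
theorem exists_polar {x v y : A}
    (hv : IsExtremalPartialIsometry v) (hx : IsUnit x) (hy : IsUnit y) :
    ∃ w k : A, IsExtremalPartialIsometry w ∧ IsUnit k ∧ 0 ≤ k ∧
      Commute k (star w * w) ∧ x * v * y = w * k := by
  obtain ⟨w, k, hw, hk, hks, -, h⟩ := hv.star.exists_polar_of_isUnit_mul hy.star
  obtain ⟨w', k', hw', hk', hks', hc, h'⟩ := hw.star.exists_polar_of_isUnit_mul (hx.mul hk)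
  refine ⟨w', k', hw', hk', hks', hc, ?_⟩
  rw [← h', mul_assoc, mul_assoc, ← hks.isSelfAdjoint.star_eq, ← star_mul, ← h]
  simp

end Polar

/-- If a quasi-invertible element lifts a partial isometry, so does its polar part. -/
theorem exists_lift_of_map_eq {M C : Type*} [CStarAlgebra M] [CStarAlgebra C] (π : M →⋆ₐ[ℂ] C)
    {x v y : M} (hv : IsExtremalPartialIsometry v) (hx : IsUnit x) (hy : IsUnit y)
    {u : C} (hu : u * star u * u = u) (h : π (x * v * y) = u) :
    ∃ w : M, IsExtremalPartialIsometry w ∧ π w = u := by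
  let _ := CStarAlgebra.spectralOrder M
  have _ := CStarAlgebra.spectralOrderedRing M
  obtain ⟨w, k, hw, hk, hk0, hc, hd⟩ := hv.exists_polar hx hy
  have hk1 : IsUnit (π (k + 1)) :=
    (CStarAlgebra.isUnit_of_le (1 : M) (le_add_of_nonneg_left hk0)).map π
  have hW : π w * (star (π w) * π w) = π w := by
    rw [← mul_assoc, ← map_star, ← map_mul, ← map_mul, hw.mul_star_mul_self]
  have hcomm : π k * (star (π w) * π w) = star (π w) * π w * π k := by
    simpa [map_star] using congrArg π hc.eq
  have hkstar : star (π k) = π k := by rw [← map_star, hk0.isSelfAdjoint.star_eq]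
  have hu' : π w * π k = u := by rw [← map_mul, ← hd, h]
  have hsq : π w * π k * π k = π w := by
    refine (hk.map π).mul_right_cancel ?_
    calc π w * π k * π k * π k
        = π w * (star (π w) * π w * π k) * π k * π k := by rw [← mul_assoc (π w), hW]
      _ = π w * π k * (star (π w) * π w * π k) * π k := by
        conv_lhs => rw [← hcomm]
        simp only [mul_assoc]
      _ = π w * π k * star (π w * π k) * (π w * π k) := by
        rw [← hcomm, star_mul, hkstar]; simp only [mul_assoc]
      _ = π w * π k := by rw [hu', hu]
  refine ⟨w, hw, ?_⟩
  rw [← hu']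
  refine hk1.mul_right_cancel ?_
  rw [map_add, map_one, mul_add, mul_add, hsq, mul_one, mul_one, add_comm]

/-- Every element close to an extremal partial isometry is of the form `g * u * s` with explicit
`g` and `s`. -/
theorem mul_mul_eq {C : Type*} [CStarAlgebra C] {u : C} (hu : IsExtremalPartialIsometry u) {c : C}
    {s : Cˣ} (hs : (s : C) = 1 + star u * (c - u)) :
    (1 + (1 - u * star u) * c * (s⁻¹ : Cˣ) * star u) * u * s = c := by
  have h1 := hu.defect_mul_mul_defect (c * (s⁻¹ : Cˣ))
  have h2 : (1 - u * star u) * c * (s⁻¹ : Cˣ) * star u * u = (1 - u * star u) * c * (s⁻¹ : Cˣ) := by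
    rw [mul_sub, mul_one, sub_eq_zero] at h1
    simpa only [mul_assoc] using h1.symm
  rw [add_mul, one_mul, h2, add_mul, Units.inv_mul_cancel_right, hs, mul_add, mul_one, mul_sub,
    mul_sub, ← mul_assoc u, ← mul_assoc u, hu.mul_star_mul_self]
  noncomm_ring

end IsExtremalPartialIsometry

/-- Extremal partial isometries lift from quotients of extremally rich C*-algebras. -/
theorem ExtremallyRich.exists_lift {M C : Type*} [CStarAlgebra M] [CStarAlgebra C]
    (hM : ExtremallyRich M) (π : M →⋆ₐ[ℂ] C) (hπ : Function.Surjective π) {u : C}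
    (hu : IsExtremalPartialIsometry u) : ∃ w : M, IsExtremalPartialIsometry w ∧ π w = u := by
  obtain ⟨U, rfl⟩ := hπ u
  let S : M → M := fun D => 1 + star U * (D - U)
  let G : M → M := fun D => 1 + (1 - U * star U) * (D - U) * Ring.inverse (S D) * star U
  have hSU : S U = 1 := by simp [S]
  have hGU : G U = 1 := by simp [G]
  have hScont : Continuous S := by fun_prop
  have hGcont : ContinuousAt G U := by
    have h1 : ContinuousAt Ring.inverse (S U) := by
      rw [hSU]; exact NormedRing.inverse_continuousAt 1
    have h2 : ContinuousAt (fun D => Ring.inverse (S D)) U :=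
      ContinuousAt.comp (f := S) h1 hScont.continuousAt
    fun_prop
  have hS : ∀ᶠ D in nhds U, IsUnit (S D) :=
    hScont.continuousAt.eventually_mem (by rw [hSU]; exact Units.nhds 1)
  have hG : ∀ᶠ D in nhds U, IsUnit (G D) :=
    hGcont.eventually_mem (by rw [hGU]; exact Units.nhds 1)
  obtain ⟨D, ⟨x, v, y, hx, hy, hv, hD⟩, hS, hG⟩ := hM.inter_nhds_nonempty (hS.and hG)
  subst hD
  rw [mem_extremePoints_closedBall_iff] at hv
  obtain ⟨s, hs⟩ := hS
  obtain ⟨g, hg⟩ := hG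
  have hsπ : π (s⁻¹ : Mˣ) = ((Units.map (π : M →* C) s)⁻¹ : Cˣ) := rfl
  have h1 := hu.mul_mul_eq (c := π (x * v * y)) (s := Units.map (π : M →* C) s)
    (by simp [hs, S, map_star])
  refine hv.exists_lift_of_map_eq π (g⁻¹.isUnit.mul hx) (hy.mul s⁻¹.isUnit)
    hu.mul_star_mul_self ?_
  have h2 : π g = 1 + (1 - π U * star (π U)) * π (x * v * y) *
      ((Units.map (π : M →* C) s)⁻¹ : Cˣ) * star (π U) := by
    have h0 : (1 - π U * star (π U)) * π U = 0 := by
      rw [sub_mul, one_mul, hu.mul_star_mul_self, sub_self]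
    rw [hg, ← hsπ]
    simp only [G, ← hs, Ring.inverse_unit, map_add, map_mul, map_sub, map_one, map_star, mul_sub,
      h0, sub_zero]
  rw [← h2] at h1
  calc π (g⁻¹ * x * v * (y * s⁻¹)) = π (g⁻¹ : Mˣ) * π (x * v * y) * π (s⁻¹ : Mˣ) := by
        simp only [map_mul, mul_assoc]
    _ = π (g⁻¹ : Mˣ) * (π g * π U * π s) * π (s⁻¹ : Mˣ) := by
        rw [← h1]; rfl
    _ = π ((g⁻¹ : Mˣ) * g * U * (s * (s⁻¹ : Mˣ))) := by simp only [map_mul, mul_assoc]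
    _ = π U := by simp

theorem DoubleCentralizer.eq_zero_of_coe_eq_zero {I : Type*}
    [NonUnitalCStarAlgebra I] {x : I} (h : (x : 𝓜(ℂ, I)) = 0) : x = 0 := by
  have := congrArg (fun m : 𝓜(ℂ, I) => m.fst (star x)) h
  simpa [CStarRing.mul_star_self_eq_zero_iff] using this


/-- Let `I` be a C*-algebra whose multiplier algebra `𝓜(ℂ, I)` is
extremally rich, and suppose a unital C*-algebra `A` contains `I` as a closed two-sided
ideal (via the isometric embedding `ι`), with `q : A → B` realizing the quotient `B = A/I`.
Let `π : 𝓜(ℂ, I) → C` realize the corona algebra `C = C(I) = 𝓜(ℂ, I)/I` (so `π` is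
surjective with kernel the canonical image of `I` in `𝓜(ℂ, I)`), let `φ : A → 𝓜(ℂ, I)` be
the canonical map (characterized by extending the canonical embedding of `I`), and let
`τ : B → C` be the Busby invariant (characterized by `τ ∘ q = π ∘ φ`).  If `τ` maps extreme
points of the closed unit ball of `B` to extreme points of the closed unit ball of `C`,
then every extremal partial isometry in `A/I` lifts to an extremal partial isometry in `A`. -/
theorem stmt6 {I A B C : Type*} [NonUnitalCStarAlgebra I] [CStarAlgebra A] [CStarAlgebra B]
    [CStarAlgebra C]
    (hM : ExtremallyRich 𝓜(ℂ, I))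
    (ι : I →⋆ₙₐ[ℂ] A) (hιisom : Isometry ι)
    (hideal : ∀ (a : A) (x : I), a * ι x ∈ Set.range ι ∧ ι x * a ∈ Set.range ι)
    (q : A →⋆ₐ[ℂ] B) (hqsurj : Function.Surjective q)
    (hker : ∀ a : A, q a = 0 ↔ a ∈ Set.range ι)
    (π : 𝓜(ℂ, I) →⋆ₐ[ℂ] C) (hπsurj : Function.Surjective π)
    (hπker : ∀ m : 𝓜(ℂ, I), π m = 0 ↔ ∃ x : I, m = (x : 𝓜(ℂ, I)))
    (φ : A →⋆ₐ[ℂ] 𝓜(ℂ, I)) (hφ : ∀ x : I, φ (ι x) = (x : 𝓜(ℂ, I)))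
    (τ : B →⋆ₐ[ℂ] C) (hτ : ∀ a : A, τ (q a) = π (φ a))
    (hext : ∀ u ∈ Set.extremePoints ℝ (Metric.closedBall (0 : B) 1),
      τ u ∈ Set.extremePoints ℝ (Metric.closedBall (0 : C) 1)) :
    ∀ u ∈ Set.extremePoints ℝ (Metric.closedBall (0 : B) 1),
      ∃ v ∈ Set.extremePoints ℝ (Metric.closedBall (0 : A) 1), q v = u := by
  intro u hu
  have hτu := (mem_extremePoints_closedBall_iff _).1 (hext u hu)
  obtain ⟨w, hw, hwu⟩ := hM.exists_lift π hπsurj hτu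
  rw [mem_extremePoints_closedBall_iff] at hu
  obtain ⟨a, rfl⟩ := hqsurj u
  obtain ⟨x, hx⟩ := (hπker (φ a - w)).1 (by rw [map_sub, hwu, hτ, sub_self])
  have hqv : q (a - ι x) = q a := by
    rw [map_sub, (hker (ι x)).2 ⟨x, rfl⟩, sub_zero]
  have hφv : φ (a - ι x) = w := by rw [map_sub, hφ, ← hx, sub_sub_cancel]
  have hzero : ∀ z : A, q z = 0 → φ z = 0 → z = 0 := by
    intro z hqz hφz
    obtain ⟨y, rfl⟩ := (hker z).1 hqz
    rw [hφ] at hφz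
    rw [DoubleCentralizer.eq_zero_of_coe_eq_zero hφz, map_zero]
  refine ⟨a - ι x, (mem_extremePoints_closedBall_iff _).2 ⟨?_, fun b => ?_⟩, hqv⟩
  · rw [← sub_eq_zero]
    apply hzero
    · rw [map_sub, map_mul, map_mul, map_star, hqv, hu.mul_star_mul_self, sub_self]
    · rw [map_sub, map_mul, map_mul, map_star, hφv, hw.mul_star_mul_self, sub_self]
  · apply hzero
    · simp only [map_mul, map_sub q 1, map_star, map_one, hqv, hu.defect_mul_mul_defect]
    · simp only [map_mul, map_sub φ 1, map_star, map_one, hφv, hw.defect_mul_mul_defect]
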